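/- arXiv:2307.15511 — 2 statements merged into one kernel-verified Lean document; each statement's English description precedes it below -/
import Mathlib

section
/- Let X be a complex Banach space that is a linear subspace of L^1(T) such that f(·+a) ∈ X whenever f ∈ X and a ∈ T, and such that for every k ∈ ℤ the function x ↦ e^{ikx} belongs to X. Suppose the norm of X satisfies (H1*), (H3*), and ‖e^{ik·}‖_X = O(|k|^α) as |k| → ∞ for some α ≥ 0. If a function f ∈ X satisfies ∑_{|k| ≥ n+1} |k|^{αp} |f̂(k)|^p = O(1/n^{p-1}) as n → ∞ for some p ≥ 1, then the symmetric partial sums S_n(·,f) of the Fourier series of f converge to f in the norm of X. -/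
open MeasureTheory Filter Topology AddCircle

instance fact_two_pi_pos : Fact (0 < 2 * Real.pi) := ⟨Real.two_pi_pos⟩

/-- Tauberian lemma: Cesaro convergence and slow oscillation give convergence. -/
lemma aux_tauber {X : Type*} [NormedAddCommGroup X] [NormedSpace ℝ X] (S : ℕ → X) (f : X)
    (hσ : Tendsto (fun N : ℕ => (N : ℝ)⁻¹ • ∑ j ∈ Finset.range N, S j) atTop (𝓝 f))
    (hosc : ∀ ε > 0, ∃ K : ℕ, 0 < K ∧ ∀ᶠ n : ℕ in atTop, ∀ j, n ≤ j → j ≤ n + n / K →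
      ‖S j - S n‖ ≤ ε) :
    Tendsto S atTop (𝓝 f) := by
  rw [Metric.tendsto_atTop]
  intro ε hε
  obtain ⟨K, hK, hev⟩ := hosc (ε / 4) (by positivity)
  rw [eventually_atTop] at hev
  obtain ⟨n₁, hn₁⟩ := hev
  rw [Metric.tendsto_atTop] at hσ
  have hKr : (0 : ℝ) < K := by exact_mod_cast hK
  obtain ⟨n₂, hn₂⟩ := hσ (ε / 4 / (2 * K + 1)) (by positivity)
  refine ⟨max (max n₁ n₂) K, fun n hn => ?_⟩
  have h1 : n₁ ≤ n := le_trans (le_trans (le_max_left _ _) (le_max_left _ _)) hn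
  have h2 : n₂ ≤ n := le_trans (le_trans (le_max_right _ _) (le_max_left _ _)) hn
  have h3 : K ≤ n := le_trans (le_max_right _ _) hn
  set d := n / K with hd
  have hd1 : 1 ≤ d := (Nat.one_le_div_iff hK).2 h3
  have hnd : n ≤ 2 * K * d := by
    have := Nat.lt_mul_div_succ n hK
    rw [← hd] at this
    nlinarith
  have hn0 : 0 < n := lt_of_lt_of_le hK h3
  have key : (d : ℝ) • (S n - f) = (∑ i ∈ Finset.range d, (S n - S (n + i)))
      + (((n + d : ℕ) : ℝ) • (((n + d : ℕ) : ℝ)⁻¹ • (∑ j ∈ Finset.range (n + d), S j) - f)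
      - (n : ℝ) • ((n : ℝ)⁻¹ • (∑ j ∈ Finset.range n, S j) - f)) := by
    have e1 : ((n + d : ℕ) : ℝ) ≠ 0 := by positivity
    have e2 : (n : ℝ) ≠ 0 := by positivity
    rw [smul_sub, smul_sub, smul_sub, smul_inv_smul₀ e1, smul_inv_smul₀ e2,
      Finset.sum_range_add, Finset.sum_sub_distrib, Finset.sum_const, Finset.card_range,
      ← Nat.cast_smul_eq_nsmul ℝ]
    push_cast
    rw [add_smul]
    abel
  have b1 : ‖∑ i ∈ Finset.range d, (S n - S (n + i))‖ ≤ d * (ε / 4) := by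
    refine (norm_sum_le _ _).trans ?_
    refine (Finset.sum_le_card_nsmul _ _ (ε / 4) fun i hi => ?_).trans (by simp)
    rw [norm_sub_rev]
    exact hn₁ n h1 _ (by omega) (by have := Finset.mem_range.1 hi; omega)
  have b2 : ∀ m : ℕ, n₂ ≤ m → m ≤ (2 * K + 1) * d →
      ‖(m : ℝ) • ((m : ℝ)⁻¹ • (∑ j ∈ Finset.range m, S j) - f)‖ ≤ d * (ε / 4) := by
    intro m hm hm'
    have := (hn₂ m hm).le
    rw [dist_eq_norm] at this
    rw [norm_smul, Real.norm_natCast]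
    have hm'' : (m : ℝ) ≤ (2 * K + 1) * d := by exact_mod_cast hm'
    calc _ ≤ ((2 * K + 1) * d) * (ε / 4 / (2 * K + 1)) := by gcongr
      _ = _ := by field_simp
  have h := congrArg norm key
  rw [norm_smul, Real.norm_natCast] at h
  have hfin : (d : ℝ) * ‖S n - f‖ ≤ d * (ε / 4) + (d * (ε / 4) + d * (ε / 4)) := by
    rw [h]
    refine (norm_add_le _ _).trans (add_le_add b1 ((norm_sub_le _ _).trans (add_le_add ?_ ?_)))
    · exact b2 _ (by omega) (by nlinarith)
    · exact b2 _ h2 (by nlinarith)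
  have hdr : (0 : ℝ) < d := by exact_mod_cast hd1
  rw [dist_eq_norm]
  have : ‖S n - f‖ ≤ 3 * (ε / 4) := by
    refine le_of_mul_le_mul_left ?_ hdr
    linarith
  linarith

lemma aux_sum_Icc {M : Type*} [AddCommMonoid M] (h : ℤ → M) (N : ℕ) :
    ∑ k ∈ Finset.Icc (-(((N + 1 : ℕ)) : ℤ)) ((N + 1 : ℕ) : ℤ), h k
      = (∑ k ∈ Finset.Icc (-(N : ℤ)) (N : ℤ), h k) + h (N + 1) + h (-(N + 1)) := by
  have : Finset.Icc (-(((N + 1 : ℕ)) : ℤ)) ((N + 1 : ℕ) : ℤ)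
      = insert (-((N : ℤ) + 1)) (insert ((N : ℤ) + 1) (Finset.Icc (-(N : ℤ)) (N : ℤ))) := by
    ext k
    simp only [Finset.mem_Icc, Finset.mem_insert]
    push_cast
    omega
  rw [this, Finset.sum_insert, Finset.sum_insert]
  · rw [add_comm, add_comm (h ((N : ℤ) + 1))]
  · simp
  · simp only [Finset.mem_Icc, Finset.mem_insert]
    omega

lemma aux_fourier_mul (m n : ℤ) (a : AddCircle (2 * Real.pi)) :
    fourier m a * fourier n a = fourier (m + n) a := fourier_add.symm

/-- Sum of `D_j`, expressed through real parts. -/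
lemma aux_conj_geom (a : AddCircle (2 * Real.pi)) (N : ℕ) :
    ∑ k ∈ Finset.Icc (-(N : ℤ)) (N : ℤ), fourier (-k) a
      = 1 + ∑ i ∈ Finset.range N, (fourier ((i : ℤ) + 1) a + fourier (-((i : ℤ) + 1)) a) := by
  induction N with
  | zero => simp
  | succ N ih =>
    rw [aux_sum_Icc, ih, Finset.sum_range_succ, neg_neg]
    ring

lemma aux_fejer (a : AddCircle (2 * Real.pi)) (N : ℕ) :
    ((‖∑ j ∈ Finset.range N, fourier (j : ℤ) a‖ ^ 2 : ℝ) : ℂ)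
      = ∑ j ∈ Finset.range N, ∑ k ∈ Finset.Icc (-(j : ℤ)) (j : ℤ), fourier (-k) a := by
  have hsq : ∀ z : ℂ, ((‖z‖ ^ 2 : ℝ) : ℂ) = z * (starRingEnd ℂ) z := by
    intro z; rw [Complex.mul_conj, Complex.normSq_eq_norm_sq]
  rw [hsq]
  induction N with
  | zero => simp
  | succ N ih =>
    rw [Finset.sum_range_succ, Finset.sum_range_succ _ N, ← ih, aux_conj_geom, map_add]
    have h1 : fourier (N : ℤ) a * (starRingEnd ℂ) (fourier (N : ℤ) a) = 1 := by
      rw [← fourier_neg, aux_fourier_mul]; simp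
    have h2 : (∑ j ∈ Finset.range N, fourier (j : ℤ) a) * (starRingEnd ℂ) (fourier (N : ℤ) a)
        = ∑ i ∈ Finset.range N, fourier (-((i : ℤ) + 1)) a := by
      rw [← fourier_neg, Finset.sum_mul, ← Finset.sum_range_reflect]
      refine Finset.sum_congr rfl fun i hi => ?_
      rw [aux_fourier_mul]
      have := Finset.mem_range.1 hi
      congr 2
      omega
    have h3 : fourier (N : ℤ) a * (starRingEnd ℂ) (∑ j ∈ Finset.range N, fourier (j : ℤ) a)
        = ∑ i ∈ Finset.range N, fourier ((i : ℤ) + 1) a := by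
      rw [map_sum, Finset.mul_sum, ← Finset.sum_range_reflect]
      refine Finset.sum_congr rfl fun i hi => ?_
      rw [← fourier_neg, aux_fourier_mul]
      have := Finset.mem_range.1 hi
      congr 2
      omega
    rw [Finset.sum_add_distrib, ← h2, ← h3, ← h1]
    ring

lemma aux_geom_bound (a : AddCircle (2 * Real.pi)) (N : ℕ) :
    ‖∑ j ∈ Finset.range N, fourier (j : ℤ) a‖ * ‖fourier 1 a - 1‖ ≤ 2 := by
  have hpow : ∀ j : ℕ, fourier (j : ℤ) a = (fourier 1 a) ^ j := by
    intro j
    induction j with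
    | zero => simp
    | succ j ih => rw [pow_succ, ← ih, aux_fourier_mul]; simp
  simp_rw [hpow]
  rw [← norm_mul, geom_sum_mul, ← hpow]
  refine (norm_sub_le _ _).trans ?_
  rw [fourier_apply, Circle.norm_coe]
  norm_num

/-- The Fejer kernel. -/
noncomputable def auxK (N : ℕ) (a : AddCircle (2 * Real.pi)) : ℝ :=
  (N : ℝ)⁻¹ * ‖∑ j ∈ Finset.range N, fourier (j : ℤ) a‖ ^ 2

lemma auxK_cont (N : ℕ) : Continuous (auxK N) := by
  unfold auxK
  refine continuous_const.mul ((continuous_norm.comp (continuous_finsetSum _ fun j _ => ?_)).pow 2)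
  exact (fourier (j : ℤ)).continuous

lemma auxK_nonneg (N : ℕ) (a : AddCircle (2 * Real.pi)) : 0 ≤ auxK N a := by
  unfold auxK; positivity

lemma aux_integrable_cont {E : Type*} [NormedAddCommGroup E]
    {g : AddCircle (2 * Real.pi) → E} (hg : Continuous g) :
    Integrable g (@haarAddCircle (2 * Real.pi) _) :=
  hg.integrable_of_hasCompactSupport (HasCompactSupport.of_compactSpace g)

lemma aux_integral_fourier (k : ℤ) :
    ∫ a, fourier k a ∂(@haarAddCircle (2 * Real.pi) _) = if k = 0 then 1 else 0 := by
  have h := congrFun (fourierCoeff_fourier (T := 2 * Real.pi) 0) (-k)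
  simp only [fourierCoeff, neg_neg, smul_eq_mul, fourier_zero, mul_one] at h
  rw [h]
  simp [Pi.single_apply]

lemma aux_smul_sum {X : Type*} [NormedAddCommGroup X] [NormedSpace ℂ X]
    [CompleteSpace X] (g : AddCircle (2 * Real.pi) → X) (hg : Continuous g) (N : ℕ) :
    ∫ a, auxK N a • g a ∂(@haarAddCircle (2 * Real.pi) _)
     = (N : ℝ)⁻¹ • ∑ j ∈ Finset.range N, ∑ k ∈ Finset.Icc (-(j : ℤ)) (j : ℤ),
      ∫ a, fourier (-k) a • g a ∂(@haarAddCircle (2 * Real.pi) _) := by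
  have hi : ∀ k : ℤ, Integrable (fun a => fourier (-k) a • g a)
      (@haarAddCircle (2 * Real.pi) _) := fun k =>
    aux_integrable_cont ((fourier (-k)).continuous.smul hg)
  have : ∀ a, auxK N a • g a = (N : ℝ)⁻¹ • ∑ j ∈ Finset.range N,
      ∑ k ∈ Finset.Icc (-(j : ℤ)) (j : ℤ), fourier (-k) a • g a := by
    intro a
    unfold auxK
    rw [mul_smul]
    congr 1
    rw [← Complex.coe_smul, aux_fejer]
    simp_rw [Finset.sum_smul]
  simp_rw [this]
  rw [integral_smul, integral_finsetSum]
  · congr 1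
    refine Finset.sum_congr rfl fun j _ => ?_
    rw [integral_finsetSum]
    exact fun k _ => hi k
  · exact fun j _ => integrable_finsetSum _ fun k _ => hi k

lemma auxK_integral (N : ℕ) (hN : 0 < N) :
    ∫ a, auxK N a ∂(@haarAddCircle (2 * Real.pi) _) = 1 := by
  have h := aux_smul_sum (fun _ => (1 : ℂ)) continuous_const N
  simp only [smul_eq_mul, mul_one, aux_integral_fourier, neg_eq_zero] at h
  have h2 : ∀ j : ℕ, ∑ k ∈ Finset.Icc (-(j : ℤ)) (j : ℤ), (if k = 0 then (1 : ℂ) else 0) = 1 := by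
    intro j
    rw [Finset.sum_ite_eq' (Finset.Icc (-(j : ℤ)) (j : ℤ)) 0 (fun _ => (1 : ℂ))]
    simp
  simp only [h2] at h
  have h3 : ∀ a, auxK N a • (1 : ℂ) = ((auxK N a : ℝ) : ℂ) := fun a => by simp
  simp_rw [h3] at h
  rw [integral_complex_ofReal] at h
  have hN' : (N : ℂ) ≠ 0 := by exact_mod_cast hN.ne'
  simp [hN'] at h
  exact_mod_cast h

lemma aux_approx {X : Type*} [NormedAddCommGroup X] [NormedSpace ℂ X]
    [CompleteSpace X] (g : AddCircle (2 * Real.pi) → X) (hg : Continuous g) :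
    Tendsto (fun N : ℕ => ∫ a, auxK N a • g a ∂(@haarAddCircle (2 * Real.pi) _)) atTop
      (𝓝 (g 0)) := by
  have := tendsto_setIntegral_peak_smul_of_integrableOn_of_tendsto
    (μ := @haarAddCircle (2 * Real.pi) _) (s := Set.univ) (t := Set.univ) (φ := auxK)
    (l := atTop) (g := g) (a := g 0) (x₀ := 0) MeasurableSet.univ MeasurableSet.univ
    (Set.subset_univ _) (by simp) (measure_ne_top _ _)
    (Eventually.of_forall fun N x _ => auxK_nonneg N x) ?_ ?_
    (Eventually.of_forall fun N => (auxK_cont N).aestronglyMeasurable)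
    (aux_integrable_cont hg).integrableOn hg.continuousAt.continuousWithinAt
  · simpa using this
  · intro u hu h0
    have hc : IsCompact (Set.univ \ u) := by
      rw [← Set.compl_eq_univ_sdiff]; exact hu.isClosed_compl.isCompact
    have hcont : Continuous fun a : AddCircle (2 * Real.pi) => ‖fourier 1 a - 1‖ :=
      ((fourier 1).continuous.sub continuous_const).norm
    have hδ : ∃ δ > 0, ∀ a ∈ Set.univ \ u, δ ≤ ‖(fourier 1 a : ℂ) - 1‖ := by
      rcases (Set.univ \ u).eq_empty_or_nonempty with h | h
      · exact ⟨1, one_pos, by simp [h]⟩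
      · obtain ⟨x, hx, hmin⟩ := hc.exists_isMinOn h hcont.continuousOn
        refine ⟨_, ?_, fun a ha => hmin ha⟩
        rw [gt_iff_lt, norm_pos_iff, sub_ne_zero]
        intro hx1
        apply hx.2
        have : x = 0 := by
          apply injective_toCircle (T := 2 * Real.pi) Real.two_pi_pos.ne'
          rw [toCircle_zero]
          ext
          simpa using hx1
        rwa [this]
    obtain ⟨δ, hδ, hb⟩ := hδ
    rw [Metric.tendstoUniformlyOn_iff]
    intro ε hε
    have ht : Tendsto (fun N : ℕ => (N : ℝ)⁻¹ * (2 / δ) ^ 2) atTop (𝓝 0) := by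
      simpa using (tendsto_inv_atTop_nhds_zero_nat (𝕜 := ℝ)).mul_const ((2 / δ) ^ 2)
    filter_upwards [ht.eventually (gt_mem_nhds hε)] with N hN a ha
    simp only [Pi.zero_apply, dist_zero_left, Real.norm_eq_abs, abs_of_nonneg (auxK_nonneg N a)]
    refine lt_of_le_of_lt ?_ hN
    unfold auxK
    gcongr
    rw [le_div_iff₀ hδ]
    refine le_trans ?_ (aux_geom_bound a N)
    gcongr
    exact hb a ha
  · simp only [Measure.restrict_univ]
    refine tendsto_const_nhds.congr' ?_
    filter_upwards [eventually_gt_atTop 0] with N hN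
    exact (auxK_integral N hN).symm

lemma aux_osc {X : Type*} [NormedAddCommGroup X] [NormedSpace ℂ X] (e : ℤ → X) (c : ℤ → ℂ)
    (α : ℝ)
    (hexp : ∃ C : ℝ, 0 < C ∧ ∃ k₀ : ℕ, ∀ k : ℤ, (k₀ : ℤ) ≤ |k| →
        ‖e k‖ ≤ C * (|k| : ℝ) ^ α) (p : ℝ) (hp : 1 ≤ p)
    (hSummable : Summable fun k : ℤ => (|k| : ℝ) ^ (α * p) * ‖c k‖ ^ p)
    (htail : ∃ M : ℝ, 0 < M ∧ ∃ n₀ : ℕ, ∀ n : ℕ, n₀ ≤ n →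
        (∑' k : {k : ℤ // (n : ℤ) + 1 ≤ |k|}, (|(k : ℤ)| : ℝ) ^ (α * p) * ‖c (k : ℤ)‖ ^ p)
          ≤ M / (n : ℝ) ^ (p - 1)) :
    ∀ ε > 0, ∃ K : ℕ, 0 < K ∧ ∀ᶠ n : ℕ in atTop, ∀ j, n ≤ j → j ≤ n + n / K →
      ‖∑ k ∈ Finset.Icc (-(j : ℤ)) (j : ℤ), c k • e k
        - ∑ k ∈ Finset.Icc (-(n : ℤ)) (n : ℤ), c k • e k‖ ≤ ε := by
  intro ε hε
  obtain ⟨C, hC, k₀, hk₀⟩ := hexp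
  obtain ⟨M, hM, n₀, hn₀⟩ := htail
  have hp0 : 0 < p := by linarith
  let d : ℤ → ℝ := fun k => (|k| : ℝ) ^ α * ‖c k‖
  have hd0 : ∀ k, 0 ≤ d k := fun k => by positivity
  have hdp : ∀ k : ℤ, (|k| : ℝ) ^ (α * p) * ‖c k‖ ^ p = d k ^ p := by
    intro k
    simp only [d]
    rw [Real.mul_rpow (by positivity) (by positivity), ← Real.rpow_mul (by positivity)]
  simp_rw [hdp] at hSummable hn₀
  let A : ℕ → ℕ → Finset ℤ := fun n j =>
    Finset.Icc (-(j : ℤ)) (j : ℤ) \ Finset.Icc (-(n : ℤ)) (n : ℤ)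
  have hA : ∀ n j k, k ∈ A n j → (n : ℤ) + 1 ≤ |k| := by
    intro n j k hk
    simp only [A, Finset.mem_sdiff, Finset.mem_Icc] at hk
    have := abs_cases k
    omega
  have hcard : ∀ n j, n ≤ j → (A n j).card = 2 * (j - n) := by
    intro n j hnj
    simp only [A]
    rw [Finset.card_sdiff_of_subset (Finset.Icc_subset_Icc (by omega) (by omega))]
    simp only [Int.card_Icc]
    omega
  have hbase : ∀ n j, k₀ ≤ n → n ≤ j →
      ‖∑ k ∈ Finset.Icc (-(j : ℤ)) (j : ℤ), c k • e k
        - ∑ k ∈ Finset.Icc (-(n : ℤ)) (n : ℤ), c k • e k‖ ≤ C * ∑ k ∈ A n j, d k := by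
    intro n j hk hnj
    rw [← Finset.sum_sdiff_eq_sub (Finset.Icc_subset_Icc (by omega) (by omega)), Finset.mul_sum]
    refine norm_sum_le_of_le _ fun k hkA => ?_
    rw [norm_smul]
    have h1 := hk₀ k (by have := hA n j k hkA; omega)
    calc ‖c k‖ * ‖e k‖ ≤ ‖c k‖ * (C * (|k| : ℝ) ^ α) := by gcongr
      _ = C * d k := by simp only [d]; ring
  rcases eq_or_lt_of_le hp with hp1 | hp1
  · refine ⟨1, one_pos, ?_⟩
    rw [← hp1] at hSummable
    simp only [Real.rpow_one] at hSummable
    obtain ⟨s, hs⟩ := summable_iff_vanishing_norm.1 hSummable (ε / C) (by positivity)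
    obtain ⟨B, hB⟩ : ∃ B : ℕ, ∀ k ∈ s, |k| ≤ (B : ℤ) := by
      refine ⟨∑ k ∈ s, k.natAbs, fun k hk => ?_⟩
      have := Finset.single_le_sum (f := fun k : ℤ => k.natAbs) (fun _ _ => Nat.zero_le _) hk
      rw [Int.abs_eq_natAbs]
      exact_mod_cast this
    filter_upwards [eventually_ge_atTop B, eventually_ge_atTop k₀] with n hn1 hn2 j hj _
    refine (hbase n j hn2 hj).trans ?_
    have := hs (A n j) (by
      rw [Finset.disjoint_left]
      intro k hk hk'
      have h1 := hA n j k hk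
      have h2 := hB k hk'
      omega)
    have h3 := (le_abs_self _).trans this.le
    calc C * ∑ k ∈ A n j, d k ≤ C * (ε / C) := by gcongr
      _ = ε := by field_simp
  · have hlim : Tendsto (fun K : ℕ => M * (2 * (K : ℝ)⁻¹) ^ (p - 1)) atTop (𝓝 0) := by
      have h1 : Tendsto (fun K : ℕ => 2 * (K : ℝ)⁻¹) atTop (𝓝 0) := by
        simpa using (tendsto_inv_atTop_nhds_zero_nat (𝕜 := ℝ)).const_mul 2
      have h2 := (h1.rpow_const (p := p - 1) (Or.inr (by linarith))).const_mul M
      rwa [Real.zero_rpow (by linarith), mul_zero] at h2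
    have hpos : (0 : ℝ) < (ε / C) ^ p := by positivity
    obtain ⟨K, hK, hK0⟩ := ((hlim.eventually (gt_mem_nhds hpos)).and
      (eventually_gt_atTop 0)).exists
    refine ⟨K, hK0, ?_⟩
    filter_upwards [eventually_ge_atTop n₀, eventually_ge_atTop k₀, eventually_gt_atTop 0]
      with n hn1 hn2 hn3 j hj hj'
    refine (hbase n j hn2 hj).trans ?_
    have hnr : (0 : ℝ) < n := by exact_mod_cast hn3
    have hcardle : ((A n j).card : ℝ) ≤ 2 * (K : ℝ)⁻¹ * n := by
      rw [hcard n j hj]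
      have h1 : ((n / K : ℕ) : ℝ) ≤ n / K := Nat.cast_div_le
      have h2 : ((j - n : ℕ) : ℝ) ≤ ((n / K : ℕ) : ℝ) := by
        exact_mod_cast (by omega : j - n ≤ n / K)
      push_cast [hj] at h2 ⊢
      calc _ ≤ 2 * ((n : ℝ) / K) := by linarith
        _ = _ := by ring
    have htl : ∑ k ∈ A n j, d k ^ p ≤ M / (n : ℝ) ^ (p - 1) := by
      refine le_trans ?_ (hn₀ n hn1)
      have hs' : Summable fun k : {k : ℤ // (n : ℤ) + 1 ≤ |k|} => d (k : ℤ) ^ p :=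
        hSummable.comp_injective Subtype.val_injective
      have := hs'.sum_le_tsum ((A n j).subtype (fun k => (n : ℤ) + 1 ≤ |k|))
        (fun k _ => Real.rpow_nonneg (hd0 _) _)
      refine le_trans (le_of_eq ?_) this
      rw [Finset.sum_subtype_of_mem (f := fun k => d k ^ p)]
      exact fun k hk => hA n j k hk
    have hh := Real.rpow_sum_le_const_mul_sum_rpow_of_nonneg (A n j) hp (fun k _ => hd0 k)
    have hfin : (∑ k ∈ A n j, d k) ^ p ≤ (ε / C) ^ p := by
      refine (hh.trans ?_).trans hK.le
      calc ((A n j).card : ℝ) ^ (p - 1) * ∑ k ∈ A n j, d k ^ p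
          ≤ (2 * (K : ℝ)⁻¹ * n) ^ (p - 1) * (M / (n : ℝ) ^ (p - 1)) := by
            gcongr
        _ = M * (2 * (K : ℝ)⁻¹) ^ (p - 1) := by
            rw [Real.mul_rpow (by positivity) (by positivity)]
            have : (n : ℝ) ^ (p - 1) ≠ 0 := by positivity
            field_simp
    have h4 : ∑ k ∈ A n j, d k ≤ ε / C :=
      (Real.rpow_le_rpow_iff (Finset.sum_nonneg fun k _ => hd0 k) (by positivity) hp0).1 hfin
    calc C * ∑ k ∈ A n j, d k ≤ C * (ε / C) := by gcongr
      _ = ε := by field_simp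

set_option linter.unusedSectionVars false

local notation "𝕋" => AddCircle (2 * Real.pi)
local notation "μT" => @haarAddCircle (2 * Real.pi) _

lemma aux_fourier_arg_add (k : ℤ) (x y : 𝕋) :
    fourier k (x + y) = fourier k x * fourier k y := by
  simp only [fourier_apply, smul_add, toCircle_add, Circle.coe_mul]

lemma aux_ae_right (p : 𝕋 → Prop) (h : ∀ᵐ x ∂μT, p x) (b : 𝕋) : ∀ᵐ x ∂μT, p (x + b) :=
  (measurePreserving_add_right μT b).quasiMeasurePreserving.ae h

lemma aux_ae_left (p : 𝕋 → Prop) (h : ∀ᵐ x ∂μT, p x) (b : 𝕋) : ∀ᵐ x ∂μT, p (b + x) :=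
  (measurePreserving_add_left μT b).quasiMeasurePreserving.ae h

/-- A function that is an eigenfunction for all translations is a multiple of a character. -/
lemma aux_eigen (h : 𝕋 → ℂ) (hm : AEStronglyMeasurable h μT) (k : ℤ)
    (heig : ∀ b : 𝕋, (fun x => h (x + b)) =ᵐ[μT] fun x => fourier k b * h x) :
    ∃ c : ℂ, h =ᵐ[μT] fun x => c * fourier k x := by
  obtain ⟨g, hg, hhg⟩ := hm
  have heig' : ∀ b : 𝕋, ∀ᵐ x ∂μT, g (x + b) = fourier k b * g x := by
    intro b
    have h1 : ∀ᵐ x ∂μT, h (x + b) = g (x + b) :=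
      aux_ae_right (fun x => h x = g x) hhg b
    filter_upwards [heig b, h1, hhg] with x e1 e2 e3
    rw [← e2, e1, e3]
  have hmeas : MeasurableSet {z : 𝕋 × 𝕋 | g (z.2 + z.1) = fourier k z.1 * g z.2} := by
    have hgm := hg.measurable
    refine measurableSet_eq_fun (hgm.comp (measurable_snd.add measurable_fst)) ?_
    exact ((fourier k).continuous.measurable.comp measurable_fst).mul (hgm.comp measurable_snd)
  have h2 := (Measure.ae_ae_comm (μ := μT) (ν := μT)
    (p := fun b x => g (x + b) = fourier k b * g x) hmeas).1 (Eventually.of_forall heig')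
  obtain ⟨x, hx⟩ := h2.exists
  refine ⟨fourier k (-x) * g x, ?_⟩
  have h3 : ∀ᵐ y ∂μT, g (x + (-x + y)) = fourier k (-x + y) * g x :=
    aux_ae_left (fun b => g (x + b) = fourier k b * g x) hx (-x)
  filter_upwards [h3, hhg] with y e1 e2
  rw [e2]
  rw [add_neg_cancel_left, aux_fourier_arg_add] at e1
  rw [e1]; ring

/-- Fourier coefficient bound. -/
lemma aux_coeff_bound (h : Lp ℂ 1 μT) (k : ℤ) : ‖fourierCoeff (h : 𝕋 → ℂ) k‖ ≤ ‖h‖ := by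
  rw [L1.norm_eq_integral_norm]
  refine (norm_integral_le_integral_norm _).trans (le_of_eq ?_)
  refine integral_congr_ae (Eventually.of_forall fun x => ?_)
  simp only [norm_smul, fourier_apply, Circle.norm_coe, one_mul]

/-- The Fourier coefficient as a continuous functional on `L¹`. -/
noncomputable def auxCoeff (k : ℤ) : Lp ℂ 1 μT →L[ℂ] ℂ :=
  LinearMap.mkContinuous
    { toFun := fun h => fourierCoeff (h : 𝕋 → ℂ) k
      map_add' := fun g h => by
        rw [fourierCoeff_congr_ae (Lp.coeFn_add g h)]
        exact congrFun (fourierCoeff.add (L1.integrable_coeFn g) (L1.integrable_coeFn h)) k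
      map_smul' := fun c h => by
        rw [fourierCoeff_congr_ae (Lp.coeFn_smul c h)]
        exact fourierCoeff.const_smul _ c k } 1
    (fun h => by simpa using aux_coeff_bound h k)

lemma auxCoeff_apply (k : ℤ) (h : Lp ℂ 1 μT) : auxCoeff k h = fourierCoeff (h : 𝕋 → ℂ) k := rfl

lemma aux_coeff_translate (g : 𝕋 → ℂ) (a : 𝕋) (k : ℤ) :
    fourierCoeff (fun x => g (x + a)) k = fourier k a * fourierCoeff g k := by
  unfold fourierCoeff
  have : ∀ x : 𝕋, fourier (-k) x • g (x + a)
      = fourier k a * (fourier (-k) (x + a) • g (x + a)) := by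
    intro x
    rw [aux_fourier_arg_add, smul_eq_mul, smul_eq_mul]
    have : fourier k a * fourier (-k) a = (1 : ℂ) := by rw [aux_fourier_mul]; simp
    linear_combination (-(fourier (-k) x * g (x + a))) * this
  simp_rw [this]
  rw [integral_const_mul]
  congr 1
  exact integral_add_right_eq_self (μ := μT) (fun x => fourier (-k) x • g x) a

section ops
variable {X : Type*} [NormedAddCommGroup X] [NormedSpace ℂ X] [CompleteSpace X]
    (J : X →ₗ[ℂ] Lp ℂ 1 μT)
    (hJ : Function.Injective J)
    (τ : 𝕋 → X →ₗ[ℂ] X)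
    (hτ : ∀ (a : 𝕋) (f : X), (J (τ a f) : 𝕋 → ℂ) =ᵐ[μT] fun x => (J f : 𝕋 → ℂ) (x + a))

lemma aux_J_cont (hH1 : ∃ c : ℝ, 0 < c ∧ ∀ f : X, ‖J f‖ ≤ c * ‖f‖) : Continuous J := by
  obtain ⟨c, _, hc⟩ := hH1
  exact AddMonoidHomClass.continuous_of_bound J c hc

lemma aux_tau_norm
    (hτ : ∀ (a : 𝕋) (f : X), (J (τ a f) : 𝕋 → ℂ) =ᵐ[μT] fun x => (J f : 𝕋 → ℂ) (x + a))
    (a : 𝕋) (f : X) : ‖J (τ a f)‖ = ‖J f‖ := by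
  rw [L1.norm_eq_integral_norm, L1.norm_eq_integral_norm]
  rw [integral_congr_ae (g := fun x => ‖(J f : 𝕋 → ℂ) (x + a)‖)]
  · exact integral_add_right_eq_self (μ := μT) (fun x => ‖(J f : 𝕋 → ℂ) x‖) a
  · filter_upwards [hτ a f] with x hx
    rw [hx]

lemma aux_tau_cont (hJ : Function.Injective J)
    (hτ : ∀ (a : 𝕋) (f : X), (J (τ a f) : 𝕋 → ℂ) =ᵐ[μT] fun x => (J f : 𝕋 → ℂ) (x + a))
    (hJc : Continuous J) (a : 𝕋) : Continuous (τ a) := by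
  refine (τ a).continuous_of_seq_closed_graph fun u x y hu hy => hJ ?_
  have h1 : Tendsto (fun n => J (τ a (u n))) atTop (𝓝 (J y)) := (hJc.tendsto y).comp hy
  refine tendsto_nhds_unique h1 ?_
  rw [tendsto_iff_norm_sub_tendsto_zero]
  have h2 : Tendsto (fun n => J (u n)) atTop (𝓝 (J x)) := (hJc.tendsto x).comp hu
  rw [tendsto_iff_norm_sub_tendsto_zero] at h2
  refine h2.congr fun n => ?_
  rw [← map_sub, ← map_sub, ← map_sub, aux_tau_norm J τ hτ]

lemma aux_tau_add (hJ : Function.Injective J)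
    (hτ : ∀ (a : 𝕋) (f : X), (J (τ a f) : 𝕋 → ℂ) =ᵐ[μT] fun x => (J f : 𝕋 → ℂ) (x + a))
    (a b : 𝕋) (f : X) : τ (a + b) f = τ a (τ b f) := by
  apply hJ
  apply Lp.ext
  have h1 : ∀ᵐ x ∂μT, (J (τ b f) : 𝕋 → ℂ) (x + a) = (J f : 𝕋 → ℂ) (x + a + b) :=
    aux_ae_right (fun x => (J (τ b f) : 𝕋 → ℂ) x = (J f : 𝕋 → ℂ) (x + b)) (hτ b f) a
  filter_upwards [hτ (a + b) f, hτ a (τ b f), h1] with x e1 e2 e3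
  rw [e1, e2, e3, add_assoc]

lemma aux_tau_zero (hJ : Function.Injective J)
    (hτ : ∀ (a : 𝕋) (f : X), (J (τ a f) : 𝕋 → ℂ) =ᵐ[μT] fun x => (J f : 𝕋 → ℂ) (x + a))
    (f : X) : τ 0 f = f := by
  apply hJ
  apply Lp.ext
  filter_upwards [hτ 0 f] with x e1
  rw [e1, add_zero]

lemma aux_orbit_cont (hJ : Function.Injective J)
    (hτ : ∀ (a : 𝕋) (f : X), (J (τ a f) : 𝕋 → ℂ) =ᵐ[μT] fun x => (J f : 𝕋 → ℂ) (x + a))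
    (hJc : Continuous J) (hH3 : ∀ f : X, Tendsto (fun a => ‖τ a f - f‖) (𝓝 0) (𝓝 0))
    (f : X) : Continuous fun a => τ a f := by
  rw [continuous_iff_continuousAt]
  intro a
  have h1 : Tendsto (fun b => τ b f) (𝓝 0) (𝓝 f) := tendsto_iff_norm_sub_tendsto_zero.2 (hH3 f)
  have h2 : Tendsto (fun b => τ a (τ b f)) (𝓝 0) (𝓝 (τ a f)) :=
    ((aux_tau_cont J τ hJ hτ hJc a).tendsto f).comp h1
  have h3 : Tendsto (fun b : 𝕋 => -a + b) (𝓝 a) (𝓝 0) := by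
    have : Continuous fun b : 𝕋 => -a + b := by fun_prop
    simpa using this.tendsto a
  refine (h2.comp h3).congr fun b => ?_
  simp only [Function.comp]
  rw [← aux_tau_add J τ hJ hτ, add_neg_cancel_left]

lemma aux_proj (hJ : Function.Injective J)
    (hτ : ∀ (a : 𝕋) (f : X), (J (τ a f) : 𝕋 → ℂ) =ᵐ[μT] fun x => (J f : 𝕋 → ℂ) (x + a))
    (hJc : Continuous J) (hH3 : ∀ f : X, Tendsto (fun a => ‖τ a f - f‖) (𝓝 0) (𝓝 0))
    (e : ℤ → X) (he : ∀ k : ℤ, (J (e k) : 𝕋 → ℂ) =ᵐ[μT] ⇑(@fourier (2 * Real.pi) k))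
    (f : X) (k : ℤ) :
    ∫ a, fourier (-k) a • τ a f ∂μT = fourierCoeff (J f : 𝕋 → ℂ) k • e k := by
  have horb := aux_orbit_cont J τ hJ hτ hJc hH3 f
  have hint : Integrable (fun a => fourier (-k) a • τ a f) μT :=
    aux_integrable_cont ((fourier (-k)).continuous.smul horb)
  set F := ∫ a, fourier (-k) a • τ a f ∂μT with hF
  have hτF : ∀ b, τ b F = (fourier k b : ℂ) • F := by
    intro b
    let T : X →L[ℂ] X := ⟨τ b, aux_tau_cont J τ hJ hτ hJc b⟩
    have h1 : τ b F = ∫ a, T (fourier (-k) a • τ a f) ∂μT := (T.integral_comp_comm hint).symm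
    have h2 : ∀ a, T (fourier (-k) a • τ a f)
        = (fourier k b : ℂ) • (fourier (-k) (b + a) • τ (b + a) f) := by
      intro a
      rw [aux_tau_add J τ hJ hτ, aux_fourier_arg_add, smul_smul, ← mul_assoc, aux_fourier_mul]
      simp [T]
    rw [h1]
    simp_rw [h2]
    rw [integral_smul, integral_add_left_eq_self (μ := μT) (fun a => fourier (-k) a • τ a f) b]
  obtain ⟨c, hc⟩ := aux_eigen (J F : 𝕋 → ℂ) (Lp.aestronglyMeasurable _) k (fun b => by
    have h1 := hτ b F
    rw [hτF b, map_smul] at h1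
    filter_upwards [h1, Lp.coeFn_smul (fourier k b : ℂ) (J F)] with x e1 e2
    rw [← e1, e2]; rfl)
  have hFc : F = c • e k := by
    apply hJ
    apply Lp.ext
    rw [map_smul]
    filter_upwards [hc, he k, Lp.coeFn_smul c (J (e k))] with x e1 e2 e3
    rw [e1, e3, Pi.smul_apply, e2, smul_eq_mul]
  have hcoef : c = fourierCoeff (J f : 𝕋 → ℂ) k := by
    have h1 : fourierCoeff (J F : 𝕋 → ℂ) k = c := by
      have := fourierCoeff_congr_ae hc
      rw [this, fourierCoeff.const_mul, fourierCoeff_fourier]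
      simp
    rw [← h1]
    let L : X →L[ℂ] ℂ := (auxCoeff k).comp ⟨J, hJc⟩
    have h2 : fourierCoeff (J F : 𝕋 → ℂ) k = ∫ a, L (fourier (-k) a • τ a f) ∂μT :=
      (L.integral_comp_comm hint).symm
    rw [h2]
    have h3 : ∀ a, L (fourier (-k) a • τ a f) = fourierCoeff (J f : 𝕋 → ℂ) k := by
      intro a
      rw [map_smul]
      have : L (τ a f) = fourierCoeff (J (τ a f) : 𝕋 → ℂ) k := rfl
      rw [this, fourierCoeff_congr_ae (hτ a f), aux_coeff_translate, smul_eq_mul, ← mul_assoc,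
        aux_fourier_mul]
      simp
    simp_rw [h3]
    simp
  rw [hFc, hcoef]

end ops

/-- **Convergence of Fourier series in homogeneous-type spaces** (Theorem 4). Let `X` be a
complex Banach space which is a linear subspace of `L¹(𝕋)` (realized by an injective linear
map `J` into `Lp ℂ 1 haarAddCircle`) closed under translations (realized by the operators
`τ a` with `J (τ a f) = f(· + a)` a.e.) and containing the exponentials `e^{ikx}` (realized
by `e : ℤ → X` with `J (e k) = fourier k` a.e.). Suppose the norm of `X` satisfies (H1*),
(H3*), and `‖e^{ik·}‖_X = O(|k|^α)` as `|k| → ∞` for some `α ≥ 0`. If `f ∈ X` satisfies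
`∑_{|k| ≥ n+1} |k|^{αp} |f̂(k)|^p = O(1/n^{p-1})` as `n → ∞` for some `p ≥ 1`, then the
symmetric partial sums of the Fourier series of `f` converge to `f` in `X`. -/
theorem fourier_series_converges_in_homogeneous_space
    {X : Type*} [NormedAddCommGroup X] [NormedSpace ℂ X] [CompleteSpace X]
    (J : X →ₗ[ℂ] Lp ℂ 1 (@haarAddCircle (2 * Real.pi) _))
    (hJ : Function.Injective J)
    (τ : AddCircle (2 * Real.pi) → X →ₗ[ℂ] X)
    (hτ : ∀ (a : AddCircle (2 * Real.pi)) (f : X),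
      (J (τ a f) : AddCircle (2 * Real.pi) → ℂ)
        =ᵐ[haarAddCircle] fun x => (J f : AddCircle (2 * Real.pi) → ℂ) (x + a))
    (e : ℤ → X)
    (he : ∀ k : ℤ, (J (e k) : AddCircle (2 * Real.pi) → ℂ)
        =ᵐ[haarAddCircle] ⇑(@fourier (2 * Real.pi) k))
    (hH1 : ∃ c : ℝ, 0 < c ∧ ∀ f : X, ‖J f‖ ≤ c * ‖f‖)
    (hH3 : ∀ f : X, Tendsto (fun a => ‖τ a f - f‖) (𝓝 0) (𝓝 0))
    (α : ℝ) (hα : 0 ≤ α)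
    (hexp : ∃ C : ℝ, 0 < C ∧ ∃ k₀ : ℕ, ∀ k : ℤ, (k₀ : ℤ) ≤ |k| →
        ‖e k‖ ≤ C * (|k| : ℝ) ^ α)
    (f : X) (p : ℝ) (hp : 1 ≤ p)
    (hSummable : Summable fun k : ℤ =>
        (|k| : ℝ) ^ (α * p) * ‖fourierCoeff (J f : AddCircle (2 * Real.pi) → ℂ) k‖ ^ p)
    (htail : ∃ M : ℝ, 0 < M ∧ ∃ n₀ : ℕ, ∀ n : ℕ, n₀ ≤ n →
        (∑' k : {k : ℤ // (n : ℤ) + 1 ≤ |k|},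
            (|(k : ℤ)| : ℝ) ^ (α * p) *
              ‖fourierCoeff (J f : AddCircle (2 * Real.pi) → ℂ) (k : ℤ)‖ ^ p)
          ≤ M / (n : ℝ) ^ (p - 1)) :
    Tendsto (fun n : ℕ => ∑ k ∈ Finset.Icc (-(n : ℤ)) (n : ℤ),
        fourierCoeff (J f : AddCircle (2 * Real.pi) → ℂ) k • e k) atTop (𝓝 f) := by
  have hJc := aux_J_cont J hH1
  have horb := aux_orbit_cont J τ hJ hτ hJc hH3 f
  have hap := aux_approx _ horb
  simp only [aux_smul_sum _ horb, aux_proj J τ hJ hτ hJc hH3 e he f,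
    aux_tau_zero J τ hJ hτ f] at hap
  exact aux_tauber _ f hap (aux_osc e _ α hexp p hp hSummable htail)
end

section
/- Let f : T → ℂ be integrable (f ∈ L^1(T)) and suppose that for some p > 1 its Fourier coefficients satisfy ∑_{|k| ≥ n+1} |f̂(k)|^p = O(1/n^{p-1}) as n → ∞. Then the symmetric partial sums S_n(x,f) of the Fourier series of f converge to f(x) uniformly, as n → ∞, on every closed subset K of C_f, the set of all points of T at which f is continuous. -/
open MeasureTheory Filter Topology AddCircle

lemma hardy_double_sum_succ (g : ℤ → ℂ) (N : ℕ) :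
    (∑ j ∈ Finset.range (N+1), ∑ l ∈ Finset.range (N+1), g ((j:ℤ) - l))
      = (∑ j ∈ Finset.range N, ∑ l ∈ Finset.range N, g ((j:ℤ) - l))
        + ∑ k ∈ Finset.Icc (-(N:ℤ)) (N:ℤ), g k := by
  have key : ∀ n : ℕ, ∑ k ∈ Finset.Icc (-(n:ℤ)) (n:ℤ), g k
      = g 0 + (∑ i ∈ Finset.range n, g ((i:ℤ)+1)) + ∑ i ∈ Finset.range n, g (-((i:ℤ)+1)) := by
    intro n
    induction n with
    | zero => simp
    | succ n ih =>
      have : Finset.Icc (-((n+1:ℕ):ℤ)) ((n+1:ℕ):ℤ)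
          = insert ((n:ℤ)+1) (insert (-((n:ℤ)+1)) (Finset.Icc (-(n:ℤ)) (n:ℤ))) := by
        ext k; simp only [Finset.mem_Icc, Finset.mem_insert]; push_cast; omega
      rw [this, Finset.sum_insert, Finset.sum_insert, ih, Finset.sum_range_succ,
        Finset.sum_range_succ]
      · ring
      · simp
      · simp only [Finset.mem_Icc, Finset.mem_insert]; omega
  have r1 : ∑ l ∈ Finset.range N, g ((N:ℤ) - l) = ∑ i ∈ Finset.range N, g ((i:ℤ)+1) := by
    rw [← Finset.sum_range_reflect]
    refine Finset.sum_congr rfl fun i hi => ?_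
    have := Finset.mem_range.1 hi
    congr 1; omega
  have r2 : ∑ l ∈ Finset.range N, g ((l:ℤ) - N) = ∑ i ∈ Finset.range N, g (-((i:ℤ)+1)) := by
    rw [← Finset.sum_range_reflect]
    refine Finset.sum_congr rfl fun i hi => ?_
    have := Finset.mem_range.1 hi
    congr 1; omega
  rw [key, ← r1, ← r2, Finset.sum_range_succ, Finset.sum_range_succ]
  simp only [Finset.sum_range_succ, Finset.sum_add_distrib, sub_self]
  ring

lemma hardy_fourier_norm (k : ℤ) (u : AddCircle (2 * Real.pi)) : ‖(fourier k u : ℂ)‖ = 1 :=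
  Circle.norm_coe _

noncomputable def hardyG (N : ℕ) (u : AddCircle (2 * Real.pi)) : ℝ :=
  ‖∑ j ∈ Finset.range N, (fourier (j:ℤ) u : ℂ)‖ ^ 2

lemma hardyG_eq (N : ℕ) (u : AddCircle (2 * Real.pi)) :
    ((hardyG N u : ℝ) : ℂ) =
      ∑ j ∈ Finset.range N, ∑ l ∈ Finset.range N, (fourier ((j:ℤ) - l) u : ℂ) := by
  unfold hardyG
  push_cast
  rw [← Complex.mul_conj', map_sum, Finset.sum_mul_sum]
  refine Finset.sum_congr rfl fun i _ => Finset.sum_congr rfl fun j _ => ?_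
  rw [← fourier_neg, ← fourier_add, sub_eq_add_neg]

lemma hardyG_cont (N : ℕ) : Continuous (hardyG N) := by
  unfold hardyG
  fun_prop

lemma hardyG_nonneg (N : ℕ) (u) : 0 ≤ hardyG N u := by unfold hardyG; positivity

lemma hardyG_bound (δ : ℝ) (hδ : 0 < δ) :
    ∃ C : ℝ, 0 ≤ C ∧ ∀ N u, δ ≤ ‖u‖ → hardyG N u ≤ C := by
  have hc : IsCompact {u : AddCircle (2 * Real.pi) | δ ≤ ‖u‖} :=
    (isClosed_le continuous_const continuous_norm).isCompact
  have hcont : ContinuousOn (fun u : AddCircle (2 * Real.pi) => (2 / ‖(fourier 1 u : ℂ) - 1‖)^2)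
      {u | δ ≤ ‖u‖} := by
    intro u hu
    apply ContinuousAt.continuousWithinAt
    have hne : ‖(fourier 1 u : ℂ) - 1‖ ≠ 0 := by
      rw [norm_ne_zero_iff, sub_ne_zero]
      intro h
      have : toCircle u = toCircle (0 : AddCircle (2 * Real.pi)) := by
        ext; simpa [fourier_one] using h
      have := AddCircle.injective_toCircle (Real.two_pi_pos.ne') this
      subst this
      simp at hu; linarith
    have : Continuous fun u : AddCircle (2 * Real.pi) => ‖(fourier 1 u : ℂ) - 1‖ := by fun_prop
    exact (continuousAt_const.div this.continuousAt hne).pow 2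
  obtain ⟨C, hC⟩ := hc.exists_bound_of_continuousOn hcont
  refine ⟨max C 0, le_max_right _ _, fun N u hu => le_trans ?_ (le_max_left _ _)⟩
  refine le_trans ?_ ((le_abs_self _).trans (hC u hu))
  unfold hardyG
  have h1 : ∀ j : ℕ, (fourier (j:ℤ) u : ℂ) = (fourier 1 u : ℂ) ^ j := by
    intro j
    induction j with
    | zero => simp
    | succ j ih => push_cast; rw [fourier_add, ih, pow_succ]
  have hne : 0 < ‖(fourier 1 u : ℂ) - 1‖ := by
    rw [norm_pos_iff, sub_ne_zero]
    intro h
    have : toCircle u = toCircle (0 : AddCircle (2 * Real.pi)) := by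
      ext; simpa [fourier_one] using h
    have := AddCircle.injective_toCircle (Real.two_pi_pos.ne') this
    subst this
    simp at hu; linarith
  have h2 := geom_sum_mul (fourier 1 u : ℂ) N
  simp_rw [h1]
  gcongr
  rw [le_div_iff₀ hne, ← norm_mul, h2]
  refine (norm_sub_le _ _).trans ?_
  rw [norm_pow, hardy_fourier_norm]
  norm_num

lemma hardy_conv (f : AddCircle (2 * Real.pi) → ℂ) (hf : Integrable f haarAddCircle) (N : ℕ)
    (x : AddCircle (2 * Real.pi)) :
    (∑ j ∈ Finset.range N, ∑ l ∈ Finset.range N,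
      fourierCoeff f ((j:ℤ) - l) • (fourier ((j:ℤ) - l) x : ℂ))
      = ∫ t, f t * (hardyG N (x - t) : ℂ) ∂haarAddCircle := by
  simp_rw [hardyG_eq, Finset.mul_sum]
  have e : ∀ (k : ℤ) (t : AddCircle (2 * Real.pi)), (fourier k (x - t) : ℂ) = fourier k x * fourier (-k) t := by
    intro k t
    simp [fourier_apply, sub_eq_add_neg, smul_add, toCircle_add, toCircle_neg]
  have hi : ∀ k : ℤ, Integrable (fun t => f t * (fourier k (x - t) : ℂ)) haarAddCircle := by
    intro k
    refine hf.mul_bdd (c := 1) ?_ ?_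
    · exact Continuous.aestronglyMeasurable (by fun_prop)
    · exact Eventually.of_forall fun t => (hardy_fourier_norm _ _).le
  rw [integral_finsetSum _ fun j _ => integrable_finsetSum _ fun l _ => hi _]
  refine Finset.sum_congr rfl fun j _ => ?_
  rw [integral_finsetSum _ fun l _ => hi _]
  refine Finset.sum_congr rfl fun l _ => ?_
  simp_rw [e]
  rw [fourierCoeff, smul_eq_mul, ← integral_mul_const]
  refine integral_congr_ae (Eventually.of_forall fun t => ?_)
  simp only [smul_eq_mul]; ring

lemma hardyG_integral (N : ℕ) (x : AddCircle (2 * Real.pi)) :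
    ∫ t, hardyG N (x - t) ∂haarAddCircle = N := by
  have h : ∫ t, (hardyG N (x - t) : ℂ) ∂haarAddCircle = N := by
    have := hardy_conv (fun _ => 1) (integrable_const _) N x
    simp only [one_mul] at this
    rw [← this]
    have hc : ∀ k : ℤ, fourierCoeff (T := 2 * Real.pi) (fun _ => (1:ℂ)) k = if k = 0 then 1 else 0 := by
      intro k
      unfold fourierCoeff
      split_ifs with hk
      · subst hk; simp
      · simp only [smul_eq_mul, mul_one]
        exact integral_eq_zero_of_add_right_eq_neg
          (fourier_add_half_inv_index (neg_ne_zero.2 hk) Real.two_pi_pos)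
    simp only [hc, sub_eq_zero, Nat.cast_inj]
    have : ∀ j ∈ Finset.range N, ∑ l ∈ Finset.range N,
       (if j = l then (1:ℂ) else 0) • (fourier ((j:ℤ) - l) x : ℂ) = 1 := by
      intro j hj
      rw [Finset.sum_eq_single_of_mem j hj]
      · simp
      · intro b _ hb; simp [Ne.symm hb]
    rw [Finset.sum_congr rfl this]; simp
  rw [integral_complex_ofReal] at h
  exact_mod_cast h

lemma hardy_fejer (f : AddCircle (2 * Real.pi) → ℂ) (hf : Integrable f haarAddCircle)
    (K : Set (AddCircle (2 * Real.pi))) (hK : IsClosed K) (hKf : K ⊆ {x | ContinuousAt f x})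
    (ε : ℝ) (hε : 0 < ε) :
    ∃ N₀ : ℕ, ∀ N ≥ N₀, ∀ x ∈ K,
      ‖(∑ j ∈ Finset.range N, ∑ l ∈ Finset.range N,
        fourierCoeff f ((j:ℤ) - l) • (fourier ((j:ℤ) - l) x : ℂ)) - N * f x‖ ≤ ε * N := by
  have hKc := hK.isCompact
  obtain ⟨B, hB⟩ := hKc.exists_bound_of_continuousOn (f := f)
    fun x hx => (hKf hx).continuousWithinAt
  have hu := hKc.uniformContinuousAt_of_continuousAt f (fun a ha => hKf ha)
    (Metric.dist_mem_uniformity (half_pos hε))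
  obtain ⟨δ, hδ, hδ'⟩ := Metric.mem_uniformity_dist.1 hu
  obtain ⟨C, hC0, hC⟩ := hardyG_bound δ hδ
  set I := ∫ t, ‖f t‖ ∂haarAddCircle
  obtain ⟨N₀, hN₀⟩ := exists_nat_ge (C * (I + B) / (ε/2))
  refine ⟨N₀, fun N hN x hx => ?_⟩
  have hg : Continuous fun t => hardyG N (x - t) := (hardyG_cont N).comp (by fun_prop)
  have hgi : Integrable (fun t => hardyG N (x - t)) haarAddCircle :=
    hg.integrable_of_hasCompactSupport (HasCompactSupport.of_compactSpace _)
  obtain ⟨D, hD⟩ := isCompact_univ.exists_bound_of_continuousOn hg.continuousOn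
  have hfg : Integrable (fun t => f t * (hardyG N (x - t) : ℂ)) haarAddCircle := by
    refine hf.mul_bdd (c := D) ?_ ?_
    · exact (Complex.continuous_ofReal.comp hg).aestronglyMeasurable
    · exact Eventually.of_forall fun t => by simpa using hD t (Set.mem_univ _)
  have e : (∑ j ∈ Finset.range N, ∑ l ∈ Finset.range N,
        fourierCoeff f ((j:ℤ) - l) • (fourier ((j:ℤ) - l) x : ℂ)) - N * f x
      = ∫ t, (f t * (hardyG N (x - t) : ℂ) - (hardyG N (x - t) : ℂ) * f x) ∂haarAddCircle := by
    have hgc : Integrable (fun t => (hardyG N (x - t) : ℂ) * f x) haarAddCircle :=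
      hgi.ofReal.mul_const _
    rw [integral_sub hfg hgc, hardy_conv f hf, integral_mul_const,
      integral_complex_ofReal, hardyG_integral]
    simp
  rw [e]
  have hb : Integrable (fun t => (ε/2) * hardyG N (x - t) + C * (‖f t‖ + B)) haarAddCircle :=
    (hgi.const_mul _).add ((hf.norm.add (integrable_const _)).const_mul _)
  have hb2 : ∫ t, ((ε/2) * hardyG N (x - t) + C * (‖f t‖ + B)) ∂haarAddCircle
      = ε/2 * N + C * (I + B) := by
    have hfc : Integrable (fun t => C * (‖f t‖ + B)) haarAddCircle :=
      (hf.norm.add (integrable_const _)).const_mul _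
    rw [integral_add (hgi.const_mul _) hfc,
      integral_const_mul, integral_const_mul, hardyG_integral,
      integral_add hf.norm (integrable_const _)]
    simp [I]
  refine (norm_integral_le_of_norm_le hb (Eventually.of_forall fun t => ?_)).trans ?_
  · have : f t * (hardyG N (x - t) : ℂ) - (hardyG N (x - t) : ℂ) * f x
        = (hardyG N (x - t) : ℂ) * (f t - f x) := by ring
    rw [this, norm_mul, Complex.norm_real, Real.norm_of_nonneg (hardyG_nonneg _ _)]
    have hg0 := hardyG_nonneg N (x - t)
    have hBx := hB x hx
    have hB0 : 0 ≤ B := (norm_nonneg _).trans hBx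
    by_cases hd : dist x t < δ
    · have h3 : dist (f x) (f t) < ε/2 := hδ' hd hx
      rw [dist_comm, dist_eq_norm] at h3
      have : 0 ≤ C * (‖f t‖ + B) := by positivity
      nlinarith
    · have h3 := hC N (x - t) (by rw [← dist_eq_norm]; exact not_lt.1 hd)
      have h4 : ‖f t - f x‖ ≤ ‖f t‖ + B := (norm_sub_le _ _).trans (by linarith)
      have := mul_le_mul h3 h4 (norm_nonneg _) hC0
      nlinarith
  · rw [hb2]
    have : C * (I + B) / (ε/2) ≤ N := hN₀.trans (by exact_mod_cast hN)
    rw [div_le_iff₀ (by positivity)] at this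
    linarith

lemma hardy_block (c : ℤ → ℂ) (p : ℝ) (hp : 1 < p)
    (hs : Summable fun k : ℤ => ‖c k‖ ^ p) (M : ℝ) (hM : 0 < M) (n₀ : ℕ)
    (h : ∀ n : ℕ, n₀ ≤ n → (∑' k : {k : ℤ // (n : ℤ) + 1 ≤ |k|}, ‖c (k : ℤ)‖ ^ p)
          ≤ M / (n : ℝ) ^ (p - 1)) (ε : ℝ) (hε : 0 < ε) :
    ∃ L : ℕ, 0 < L ∧ ∀ n : ℕ, n₀ ≤ n → L ≤ n →
      ∑ k ∈ (Finset.Icc (-((n + (n/L+1) : ℕ):ℤ)) ((n + (n/L+1) : ℕ):ℤ)) \ (Finset.Icc (-(n:ℤ)) n), ‖c k‖ ≤ ε := by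
  have ht : Tendsto (fun L : ℕ => M * (4 / (L:ℝ)) ^ (p - 1)) atTop (𝓝 0) := by
    have h1 : Tendsto (fun L : ℕ => (4 / (L:ℝ))) atTop (𝓝 0) :=
      tendsto_const_div_atTop_nhds_zero_nat 4
    have h2 := (h1.rpow_const (p := p - 1) (Or.inr (by linarith))).const_mul M
    rwa [Real.zero_rpow (by linarith), mul_zero] at h2
  obtain ⟨L, hL, hL0⟩ := ((ht.eventually_lt_const (Real.rpow_pos_of_pos hε p)).and
    (eventually_gt_atTop 0)).exists
  refine ⟨L, hL0, fun n hn hLn => ?_⟩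
  set s := (Finset.Icc (-((n + (n/L+1) : ℕ):ℤ)) ((n + (n/L+1) : ℕ):ℤ)) \ (Finset.Icc (-(n:ℤ)) n)
    with hsdef
  have hcard : (s.card : ℝ) = 2 * (n/L+1 : ℕ) := by
    have : s.card = 2 * (n/L+1) := by
      rw [hsdef, Finset.card_sdiff_of_subset, Int.card_Icc, Int.card_Icc]
      · generalize n / L = h
        omega
      · generalize n / L = h
        apply Finset.Icc_subset_Icc <;> push_cast <;> omega
    rw [this]; push_cast; ring
  have hn0 : (0:ℝ) < n := by exact_mod_cast hL0.trans_le hLn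
  have hL0' : (0:ℝ) < L := by exact_mod_cast hL0
  have hh : (s.card : ℝ) / n ≤ 4 / L := by
    rw [hcard, div_le_div_iff₀ hn0 hL0']
    have : (n/L+1) * L ≤ 2 * n := by
      have := Nat.div_mul_le_self n L
      nlinarith
    have : (((n/L+1 : ℕ) : ℝ)) * L ≤ 2 * n := by exact_mod_cast this
    nlinarith
  have h1 := Real.rpow_sum_le_const_mul_sum_rpow s (fun k => ‖c k‖) hp.le
  simp only [abs_norm] at h1
  have h2 : ∑ k ∈ s, ‖c k‖ ^ p ≤ M / (n:ℝ) ^ (p-1) := by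
    refine le_trans ?_ (h n hn)
    have hmem : ∀ k ∈ s, k ∈ {k : ℤ | (n : ℤ) + 1 ≤ |k|} := by
      intro k hk
      simp only [hsdef, Finset.mem_sdiff, Finset.mem_Icc] at hk
      simp only [Set.mem_ofPred_eq]
      by_contra hcon
      exact hk.2 (abs_le.1 (by omega))
    have hs' : Summable fun k : {k : ℤ // (n : ℤ) + 1 ≤ |k|} => ‖c (k : ℤ)‖ ^ p :=
      hs.comp_injective Subtype.val_injective
    have h3 := hs'.sum_le_tsum
      (s.subtype (fun k => (n : ℤ) + 1 ≤ |k|)) (fun i _ => by positivity)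
    refine le_trans (le_of_eq ?_) h3
    exact (Finset.sum_subtype_of_mem (fun k => ‖c k‖ ^ p) hmem).symm
  have h5 : (∑ k ∈ s, ‖c k‖) ^ p < ε ^ p := by
    refine h1.trans_lt (lt_of_le_of_lt ?_ hL)
    calc (s.card:ℝ) ^ (p-1) * ∑ k ∈ s, ‖c k‖ ^ p ≤ (s.card:ℝ) ^ (p-1) * (M / (n:ℝ) ^ (p-1)) := by
          gcongr
      _ = M * ((s.card:ℝ) / n) ^ (p-1) := by
          rw [Real.div_rpow (by positivity) hn0.le]; ring
      _ ≤ _ := by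
          gcongr
  exact ((Real.rpow_lt_rpow_iff (by positivity) hε.le (by linarith)).1 h5).le

/-- **An extended Hardy theorem** (Theorem 5). Let `f ∈ L¹(𝕋)` and suppose that for some
`p > 1` its Fourier coefficients satisfy `∑_{|k| ≥ n+1} |f̂(k)|^p = O(1/n^{p-1})` as
`n → ∞`. Then the symmetric partial sums `S_n(x,f)` of the Fourier series of `f` converge
to `f(x)` uniformly, as `n → ∞`, on every closed subset `K` of `C_f`, the set of points of
`𝕋` at which `f` is continuous. -/
theorem hardy_uniform_convergence_on_closed_subset_of_continuity_points
    (f : AddCircle (2 * Real.pi) → ℂ)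
    (hf : Integrable f haarAddCircle)
    (p : ℝ) (hp : 1 < p)
    (hSummable : Summable fun k : ℤ => ‖fourierCoeff f k‖ ^ p)
    (htail : ∃ M : ℝ, 0 < M ∧ ∃ n₀ : ℕ, ∀ n : ℕ, n₀ ≤ n →
        (∑' k : {k : ℤ // (n : ℤ) + 1 ≤ |k|}, ‖fourierCoeff f (k : ℤ)‖ ^ p)
          ≤ M / (n : ℝ) ^ (p - 1)) :
    ∀ K : Set (AddCircle (2 * Real.pi)), IsClosed K → K ⊆ {x | ContinuousAt f x} →
      TendstoUniformlyOn
        (fun (n : ℕ) (x : AddCircle (2 * Real.pi)) =>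
          ∑ k ∈ Finset.Icc (-(n : ℤ)) (n : ℤ), fourierCoeff f k • fourier k x)
        f atTop K := by
  intro K hK hKf
  obtain ⟨M, hM, n₀, hn₀⟩ := htail
  rw [Metric.tendstoUniformlyOn_iff]
  intro ε hε
  obtain ⟨L, hL0, hL⟩ := hardy_block (fourierCoeff f) p hp hSummable M hM n₀ hn₀ (ε/4) (by positivity)
  have hL0' : (0:ℝ) < L := by exact_mod_cast hL0
  obtain ⟨N₀, hN₀⟩ := hardy_fejer f hf K hK hKf (ε / (4 * (2 * L + 1))) (by positivity)
  filter_upwards [eventually_ge_atTop n₀, eventually_ge_atTop L, eventually_ge_atTop N₀]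
    with n h1 h2 h3 x hx
  have hblock := hL n h1 h2
  set g : ℤ → ℂ := fun k => fourierCoeff f k • (fourier k x : ℂ) with hg
  set S : ℕ → ℂ := fun n => ∑ k ∈ Finset.Icc (-(n:ℤ)) (n:ℤ), g k with hS
  set A : ℕ → ℂ := fun N => ∑ j ∈ Finset.range N, ∑ l ∈ Finset.range N, g ((j:ℤ) - l) with hA
  have hAS : ∀ N, A (N+1) = A N + S N := hardy_double_sum_succ g
  set h := n / L + 1 with hh
  have hsum : ∀ m, A (n + m) - A n = ∑ i ∈ Finset.range m, S (n + i) := by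
    intro m
    induction m with
    | zero => simp
    | succ m ih => rw [Finset.sum_range_succ, ← ih, ← add_assoc, hAS]; ring
  have hdiff : ∀ i ∈ Finset.range h, ‖S (n + i) - S n‖ ≤ ε/4 := by
    intro i hi
    have hi' := Finset.mem_range.1 hi
    refine le_trans ?_ hblock
    have hsub : Finset.Icc (-(n:ℤ)) n ⊆ Finset.Icc (-((n+i:ℕ):ℤ)) ((n+i:ℕ):ℤ) := by
      apply Finset.Icc_subset_Icc <;> push_cast <;> omega
    have : S (n + i) - S n = ∑ k ∈ Finset.Icc (-((n+i:ℕ):ℤ)) ((n+i:ℕ):ℤ) \ Finset.Icc (-(n:ℤ)) n, g k := by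
      simp only [hS]; rw [← Finset.sum_sdiff hsub]; simp
    rw [this]
    refine (norm_sum_le _ _).trans ?_
    have hgn : ∀ k, ‖g k‖ = ‖fourierCoeff f k‖ := by
      intro k; rw [hg]; simp only [norm_smul, hardy_fourier_norm, mul_one]
    simp_rw [hgn]
    apply Finset.sum_le_sum_of_subset_of_nonneg
    · apply Finset.sdiff_subset_sdiff _ subset_rfl
      apply Finset.Icc_subset_Icc <;> push_cast <;> omega
    · intros; positivity
  have hF1 : ‖A n - n * f x‖ ≤ _ := hN₀ n h3 x hx
  have hF2 : ‖A (n+h) - (n+h:ℕ) * f x‖ ≤ _ := hN₀ (n+h) (h3.trans (Nat.le_add_right _ _)) x hx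
  have hpos : (0:ℝ) < h := by rw [hh]; positivity
  have hnh : (n:ℝ) ≤ L * h := by
    have : n < L * (n / L + 1) := Nat.lt_mul_div_succ n hL0
    exact_mod_cast this.le
  have hid : (h:ℂ) * (S n - f x) = (A (n+h) - (n+h:ℕ) * f x) - (A n - n * f x)
      - ∑ i ∈ Finset.range h, (S (n+i) - S n) := by
    rw [Finset.sum_sub_distrib, ← hsum]; simp; ring
  have hsb : ‖∑ i ∈ Finset.range h, (S (n+i) - S n)‖ ≤ h * (ε/4) := by
    refine (norm_sum_le_of_le _ hdiff).trans ?_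
    simp
  have hfin : h * ‖S n - f x‖ ≤ h * (ε/2) := by
    have : (h:ℝ) * ‖S n - f x‖ = ‖(h:ℂ) * (S n - f x)‖ := by simp
    rw [this, hid]
    refine (norm_sub_le _ _).trans ?_
    have h6 := norm_sub_le (A (n+h) - (n+h:ℕ) * f x) (A n - n * f x)
    have h7 : ε / (4 * (2 * L + 1)) * ((n+h:ℕ):ℝ) + ε / (4 * (2 * L + 1)) * n ≤ h * (ε/4) := by
      calc _ = ε / (4 * (2 * L + 1)) * (2 * n + h) := by push_cast; ring
        _ ≤ ε / (4 * (2 * L + 1)) * ((2 * L + 1) * h) := by gcongr; linarith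
        _ = _ := by field_simp
    linarith
  have := le_of_mul_le_mul_left hfin hpos
  rw [dist_comm, dist_eq_norm]
  change ‖S n - f x‖ < ε
  linarith
end
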